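/- If P is a simple d-dimensional polytope, then its face numbers satisfy the Dehn–Sommerville relations f_ℓ(P) = ∑_{i=0}^{ℓ} (-1)^i · binom(d-i, d-ℓ) · f_i(P) for all ℓ ∈ {0,…,d}, where f_d(P) = 1. -/

import Mathlib

open Set

/-- The number of nonempty exposed faces of dimension `k` of a set
`P ⊆ ℝ^d` (dimension measured as the rank of the vector span). -/
noncomputable def faceCount (d : ℕ) (P : Set (EuclideanSpace ℝ (Fin d))) (k : ℕ) : ℕ :=
  Nat.card {F : Set (EuclideanSpace ℝ (Fin d)) //
    IsExposed ℝ P F ∧ F.Nonempty ∧ Module.finrank ℝ (vectorSpan ℝ F) = k}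

/-- A polytope `P ⊆ ℝ^d` is simple if every vertex (nonempty exposed face of
dimension `0`) is contained in exactly `d` facets (nonempty exposed faces of
dimension `d - 1`). -/
def IsSimplePolytope (d : ℕ) (P : Set (EuclideanSpace ℝ (Fin d))) : Prop :=
  ∀ F : Set (EuclideanSpace ℝ (Fin d)),
    IsExposed ℝ P F → F.Nonempty → Module.finrank ℝ (vectorSpan ℝ F) = 0 →
    Nat.card {G : Set (EuclideanSpace ℝ (Fin d)) //
      IsExposed ℝ P G ∧ G.Nonempty ∧ Module.finrank ℝ (vectorSpan ℝ G) = d - 1 ∧ F ⊆ G} = d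

section Geometry

variable {E : Type*} [NormedAddCommGroup E] [NormedSpace ℝ E]

theorem ds_exposed_data {P F : Set E} (hF : IsExposed ℝ P F) {u : E} (hu : u ∈ F) :
    ∃ m : E →L[ℝ] ℝ, u ∈ P ∧ (∀ x ∈ P, m x ≤ m u) ∧ F = {x | x ∈ P ∧ m x = m u} := by
  obtain ⟨m, hm⟩ := hF ⟨u, hu⟩
  have hu' := hu
  rw [hm] at hu'
  refine ⟨m, hu'.1, hu'.2, ?_⟩
  rw [hm]
  ext x
  constructor
  · rintro ⟨h1, h2⟩
    exact ⟨h1, le_antisymm (hu'.2 x h1) (h2 u hu'.1)⟩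
  · rintro ⟨h1, h2⟩
    exact ⟨h1, fun y hy => h2 ▸ hu'.2 y hy⟩

theorem ds_exposed_mk {P : Set E} (m : E →L[ℝ] ℝ) {u : E} (hu : u ∈ P)
    (h : ∀ x ∈ P, m x ≤ m u) : IsExposed ℝ P {x | x ∈ P ∧ m x = m u} := by
  intro _
  refine ⟨m, ?_⟩
  ext x
  constructor
  · rintro ⟨h1, h2⟩
    exact ⟨h1, fun y hy => h2 ▸ h y hy⟩
  · rintro ⟨h1, h2⟩
    exact ⟨h1, le_antisymm (h x h1) (h2 u hu)⟩

theorem ds_hull_le (V : Finset E) (m : E →L[ℝ] ℝ) (c : ℝ) (h : ∀ u ∈ V, m u ≤ c) :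
    ∀ x ∈ convexHull ℝ (V : Set E), m x ≤ c := by
  have hc : Convex ℝ {x | m x ≤ c} := convex_halfSpace_le m.toLinearMap.isLinear c
  exact fun x hx => convexHull_min (s := (V : Set E)) (fun u hu => h u hu) hc hx

open Classical in
theorem ds_hull_eq (V : Finset E) (m : E →L[ℝ] ℝ) (c : ℝ) (h : ∀ u ∈ V, m u ≤ c)
    {x : E} (hx : x ∈ convexHull ℝ (V : Set E)) (hmx : m x = c) :
    x ∈ convexHull ℝ ((V.filter (fun u => m u = c) : Finset E) : Set E) := by
  obtain ⟨w, hw0, hw1, hwx⟩ := Finset.mem_convexHull.1 hx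
  rw [Finset.centerMass_eq_of_sum_1 _ _ hw1] at hwx
  have h0 : ∑ u ∈ V, w u * (c - m u) = 0 := by
    simp only [mul_sub, Finset.sum_sub_distrib, ← Finset.sum_mul, hw1]
    rw [← hmx, ← hwx, map_sum]
    simp
  have h1 : ∀ u ∈ V, w u * (c - m u) = 0 :=
    (Finset.sum_eq_zero_iff_of_nonneg
      (fun u hu => mul_nonneg (hw0 u hu) (sub_nonneg.2 (h u hu)))).1 h0
  have h2 : ∀ u ∈ V, u ∉ V.filter (fun u => m u = c) → w u = 0 := by
    intro u hu hu'
    rcases mul_eq_zero.1 (h1 u hu) with h | h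
    · exact h
    · exact absurd (Finset.mem_filter.2 ⟨hu, by linarith⟩) hu'
  rw [Finset.mem_convexHull]
  have h3 : ∑ u ∈ V.filter (fun u => m u = c), w u = 1 := by
    rw [← hw1]
    exact Finset.sum_subset (Finset.filter_subset _ _) h2
  refine ⟨w, fun u hu => hw0 u (Finset.mem_filter.1 hu).1, h3, ?_⟩
  rw [Finset.centerMass_eq_of_sum_1 _ _ h3, ← hwx]
  refine Finset.sum_subset (Finset.filter_subset _ _) (fun u hu hu' => ?_)
  rw [h2 u hu hu', zero_smul]

/-- a face is the hull of the generators it contains -/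
theorem ds_face_hull (V : Finset E) {F : Set E}
    (hF : IsExposed ℝ (convexHull ℝ (V : Set E)) F) :
    F = convexHull ℝ ((V : Set E) ∩ F) := by
  classical
  rcases F.eq_empty_or_nonempty with h | ⟨u, hu⟩
  · subst h; simp
  obtain ⟨m, huP, hm, rfl⟩ := ds_exposed_data hF hu
  apply Set.Subset.antisymm
  · rintro x ⟨hx, hmx⟩
    have := ds_hull_eq V m (m u) (fun v hv => hm v (subset_convexHull ℝ _ hv)) hx hmx
    refine convexHull_mono ?_ this
    intro y hy
    simp only [Finset.coe_filter, Set.mem_ofPred_eq] at hy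
    exact ⟨hy.1, subset_convexHull ℝ _ hy.1, hy.2⟩
  · exact convexHull_min Set.inter_subset_right (hF.convex (convex_convexHull ℝ _))

theorem ds_faces_finite (V : Finset E) :
    {F : Set E | IsExposed ℝ (convexHull ℝ (V : Set E)) F}.Finite := by
  refine Set.Finite.subset ((V.finite_toSet.powerset).image (fun S => convexHull ℝ S)) ?_
  intro F hF
  exact ⟨(V : Set E) ∩ F, Set.inter_subset_left, (ds_face_hull V hF).symm⟩

theorem ds_eventually_small {a b : ℝ} (h : 0 < b) : ∀ᶠ ε in nhdsWithin (0:ℝ) (Set.Ioi 0), ε * a < b := by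
  have : Filter.Tendsto (fun ε : ℝ => ε * a) (nhdsWithin (0:ℝ) (Set.Ioi 0)) (nhds (0 * a)) :=
    ((continuous_id.mul continuous_const).tendsto 0).mono_left nhdsWithin_le_nhds
  rw [zero_mul] at this
  exact this.eventually (gt_mem_nhds h)

theorem ds_eventually_pos : ∀ᶠ ε in nhdsWithin (0:ℝ) (Set.Ioi 0), 0 < ε :=
  eventually_mem_nhdsWithin

theorem ds_top_vertex (V : Finset E) (φ : E →L[ℝ] ℝ) (hφ : ∀ u ∈ V, ∀ v ∈ V, φ u = φ v → u = v)
    {F : Set E} (hF : IsExposed ℝ (convexHull ℝ (V : Set E)) F) (hne : F.Nonempty) :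
    ∃ w ∈ V, w ∈ F ∧ IsExposed ℝ (convexHull ℝ (V : Set E)) {w} ∧
      ∀ x ∈ F, φ x ≤ φ w ∧ (φ x = φ w → x = w) := by
  classical
  obtain ⟨u, hu⟩ := hne
  have hFh := ds_face_hull V hF
  have hVF : (V.filter (· ∈ F)).Nonempty := by
    have : ((V : Set E) ∩ F).Nonempty := by
      rw [← convexHull_nonempty_iff (𝕜 := ℝ), ← hFh]; exact ⟨u, hu⟩
    obtain ⟨y, hy1, hy2⟩ := this
    exact ⟨y, Finset.mem_filter.2 ⟨hy1, hy2⟩⟩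
  obtain ⟨w, hw, hwmax⟩ := Finset.exists_max_image _ φ hVF
  obtain ⟨hwV, hwF⟩ := Finset.mem_filter.1 hw
  have hcoe : ((V : Set E) ∩ F) = ((V.filter (· ∈ F) : Finset E) : Set E) := by
    ext; simp
  rw [hcoe] at hFh
  have key : ∀ (U : Finset E) (n : E →L[ℝ] ℝ), w ∈ U → (∀ u ∈ U, n u ≤ n w) →
      (∀ u ∈ U, n u = n w → u = w) → ∀ x ∈ convexHull ℝ (U : Set E), n x = n w → x = w := by
    intro U n hwU h1 h2 x hx hxn
    have := ds_hull_eq U n (n w) h1 hx hxn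
    have h3 : U.filter (fun u => n u = n w) = {w} := by
      ext y
      simp only [Finset.mem_filter, Finset.mem_singleton]
      constructor
      · rintro ⟨a, b⟩; exact h2 y a b
      · rintro rfl; exact ⟨hwU, rfl⟩
    rw [h3] at this
    simpa using this
  refine ⟨w, hwV, hwF, ?_, ?_⟩
  · obtain ⟨m, hwP, hm, hFm⟩ := ds_exposed_data hF hwF
    have hev : ∀ᶠ ε in nhdsWithin (0:ℝ) (Set.Ioi 0), ∀ u ∈ V, m u < m w →
        ε * (φ u - φ w) < m w - m u := by
      rw [Finset.eventually_all]
      intro u _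
      by_cases h : m u < m w
      · filter_upwards [ds_eventually_small (a := φ u - φ w) (sub_pos.2 h)] with ε hε _ using hε
      · exact Filter.Eventually.of_forall (fun _ h' => absurd h' h)
    obtain ⟨ε, hε, hε0⟩ := (hev.and ds_eventually_pos).exists
    let n : E →L[ℝ] ℝ := m + ε • φ
    have hn : ∀ x, n x = m x + ε * φ x := fun x => rfl
    have hlt : ∀ u ∈ V, u ≠ w → n u < n w := by
      intro u hu huw
      rw [hn, hn]
      rcases lt_or_eq_of_le (hm u (subset_convexHull ℝ _ hu)) with h | h
      · have := hε u hu h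
        nlinarith
      · have huF : u ∈ F := by rw [hFm]; exact ⟨subset_convexHull ℝ _ hu, h⟩
        have h1 := hwmax u (Finset.mem_filter.2 ⟨hu, huF⟩)
        have h2 : φ u < φ w := lt_of_le_of_ne h1 (fun e => huw (hφ u hu w hwV e))
        nlinarith
    have hle : ∀ u ∈ V, n u ≤ n w := by
      intro u hu
      by_cases h : u = w
      · rw [h]
      · exact (hlt u hu h).le
    have hE := ds_exposed_mk n hwP (ds_hull_le V n (n w) hle)
    convert hE using 1
    ext x
    simp only [Set.mem_singleton_iff, Set.mem_ofPred_eq]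
    constructor
    · rintro rfl; exact ⟨hwP, rfl⟩
    · rintro ⟨h1, h2⟩
      refine key V n hwV hle ?_ x h1 h2
      intro u hu he
      by_contra hne
      exact absurd he (hlt u hu hne).ne
  · intro x hx
    rw [hFh] at hx
    refine ⟨ds_hull_le _ φ _ hwmax x hx, key _ φ hw hwmax ?_ x hx⟩
    intro u hu he
    exact hφ u (Finset.mem_filter.1 hu).1 w hwV he

theorem ds_const_on_span {S : Set E} (k : E →ₗ[ℝ] ℝ) (c : ℝ) (h : ∀ x ∈ S, k x = c) :
    vectorSpan ℝ S ≤ LinearMap.ker k := by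
  rw [vectorSpan_def, Submodule.span_le]
  rintro _ ⟨a, ha, b, hb, rfl⟩
  simp [h a ha, h b hb]

theorem ds_eq_zero_of_const [FiniteDimensional ℝ E] {S : Set E}
    (hS : Module.finrank ℝ (vectorSpan ℝ S) = Module.finrank ℝ E)
    (k : E →ₗ[ℝ] ℝ) (c : ℝ) (h : ∀ x ∈ S, k x = c) : k = 0 := by
  have h1 := ds_const_on_span k c h
  rw [Submodule.eq_top_of_finrank_eq hS, top_le_iff, LinearMap.ker_eq_top] at h1
  exact h1

theorem ds_rotate [FiniteDimensional ℝ E] (V : Finset E)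
    (hdim : Module.finrank ℝ (vectorSpan ℝ (convexHull ℝ (V : Set E))) = Module.finrank ℝ E)
    (p : E) (m : E →L[ℝ] ℝ) (u0 : E) (hu0 : u0 ∈ convexHull ℝ (V : Set E))
    (hm : ∀ x ∈ convexHull ℝ (V : Set E), m x ≤ m u0) (hp : m u0 < m p)
    (hr : Module.finrank ℝ (vectorSpan ℝ {x | x ∈ convexHull ℝ (V : Set E) ∧ m x = m u0}) + 1
      < Module.finrank ℝ E) :
    ∃ m' : E →L[ℝ] ℝ, (∀ x ∈ convexHull ℝ (V : Set E), m' x ≤ m' u0) ∧ m' u0 < m' p ∧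
      Module.finrank ℝ (vectorSpan ℝ {x | x ∈ convexHull ℝ (V : Set E) ∧ m x = m u0}) <
      Module.finrank ℝ (vectorSpan ℝ {x | x ∈ convexHull ℝ (V : Set E) ∧ m' x = m' u0}) := by
  classical
  set W := vectorSpan ℝ {x | x ∈ convexHull ℝ (V : Set E) ∧ m x = m u0} with hW
  have hlt : W ⊔ Submodule.span ℝ {p - u0} < ⊤ := by
    rw [lt_top_iff_ne_top]
    intro htop
    have h1 := Submodule.finrank_add_le_finrank_add_finrank W (Submodule.span ℝ {p - u0})
    have h2 := finrank_span_le_card (R := ℝ) ({p - u0} : Set E)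
    rw [htop, finrank_top] at h1
    simp at h2
    omega
  obtain ⟨k0, hk0, hker⟩ := Submodule.exists_le_ker_of_lt_top _ hlt
  have hexk : ∃ k : E →ₗ[ℝ] ℝ, W ⊔ Submodule.span ℝ {p - u0} ≤ LinearMap.ker k ∧
      ∃ u ∈ V, k u0 < k u := by
    by_contra! hcon
    have h1 := hcon k0 hker
    have h2 := hcon (-k0) (fun x hx => by simpa using hker hx)
    have h3 : ∀ u ∈ V, k0 u = k0 u0 := fun u hu =>
      le_antisymm (h1 u hu) (by simpa using h2 u hu)
    apply hk0
    refine ds_eq_zero_of_const hdim k0 (k0 u0) ?_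
    intro x hx
    have a1 := ds_hull_le V (LinearMap.toContinuousLinearMap k0) (k0 u0)
      (fun u hu => (h3 u hu).le) x hx
    have a2 := ds_hull_le V (-LinearMap.toContinuousLinearMap k0) (-k0 u0)
      (fun u hu => by simp [h3 u hu]) x hx
    simp at a1 a2
    linarith
  obtain ⟨k, hkker, u2, hu2, hku2⟩ := hexk
  have hkW : ∀ x ∈ W, k x = 0 := fun x hx => hkker (Submodule.mem_sup_left hx)
  have hkp : k p = k u0 := by
    have : k (p - u0) = 0 := hkker (Submodule.mem_sup_right (Submodule.mem_span_singleton_self _))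
    rw [map_sub] at this; linarith
  obtain ⟨u1, hu1, hmin⟩ := Finset.exists_min_image (V.filter (fun u => k u0 < k u))
    (fun u => (m u0 - m u) / (k u - k u0)) ⟨u2, Finset.mem_filter.2 ⟨hu2, hku2⟩⟩
  obtain ⟨hu1V, hku1⟩ := Finset.mem_filter.1 hu1
  set t := (m u0 - m u1) / (k u1 - k u0) with ht
  have ht0 : 0 ≤ t := div_nonneg (by linarith [hm u1 (subset_convexHull ℝ _ hu1V)]) (by linarith)
  let m' : E →L[ℝ] ℝ := m + t • LinearMap.toContinuousLinearMap k
  have hm' : ∀ x, m' x = m x + t * k x := fun x => rfl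
  have hface : ∀ x, x ∈ convexHull ℝ (V : Set E) → m x = m u0 → k x = k u0 := by
    intro x hx hxm
    have : x - u0 ∈ W := vsub_mem_vectorSpan ℝ (show x ∈ {x | x ∈ convexHull ℝ (V : Set E) ∧ m x = m u0} from ⟨hx, hxm⟩) ⟨hu0, rfl⟩
    have := hkW _ this
    rw [map_sub] at this; linarith
  have hu1eq : m' u1 = m' u0 := by
    have : t * (k u1 - k u0) = m u0 - m u1 := by
      rw [ht]; exact div_mul_cancel₀ _ (by linarith)
    rw [hm', hm']; linarith
  refine ⟨m', ds_hull_le V m' _ ?_, ?_, ?_⟩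
  · intro u hu
    rw [hm', hm']
    by_cases hk : k u0 < k u
    · have := hmin u (Finset.mem_filter.2 ⟨hu, hk⟩)
      have h2 := (le_div_iff₀ (by linarith : 0 < k u - k u0)).1 this
      linarith
    · have := hm u (subset_convexHull ℝ _ hu)
      nlinarith
  · rw [hm', hm', hkp]; linarith
  · apply Submodule.finrank_lt_finrank_of_lt
    refine lt_of_le_of_ne (vectorSpan_mono ℝ ?_) ?_
    · rintro x ⟨hx, hxm⟩
      exact ⟨hx, by rw [hm', hm', hxm, hface x hx hxm]⟩
    · intro heq
      have h1 : u1 - u0 ∈ W := by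
        rw [heq]
        exact vsub_mem_vectorSpan ℝ (show u1 ∈ {x | x ∈ convexHull ℝ (V : Set E) ∧ m' x = m' u0} from ⟨subset_convexHull ℝ _ hu1V, hu1eq⟩) ⟨hu0, rfl⟩
      have := hkW _ h1
      rw [map_sub] at this; linarith

theorem ds_facet_sep [FiniteDimensional ℝ E] (V : Finset E)
    (hdim : Module.finrank ℝ (vectorSpan ℝ (convexHull ℝ (V : Set E))) = Module.finrank ℝ E)
    (hne : (convexHull ℝ (V : Set E)).Nonempty)
    (p : E) (hp : p ∉ convexHull ℝ (V : Set E)) :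
    ∃ (m : E →L[ℝ] ℝ) (u0 : E), u0 ∈ convexHull ℝ (V : Set E) ∧
      (∀ x ∈ convexHull ℝ (V : Set E), m x ≤ m u0) ∧ m u0 < m p ∧
      Module.finrank ℝ (vectorSpan ℝ {x | x ∈ convexHull ℝ (V : Set E) ∧ m x = m u0}) + 1
        = Module.finrank ℝ E := by
  have hcpt : IsCompact (convexHull ℝ (V : Set E)) := V.finite_toSet.isCompact_convexHull ℝ
  obtain ⟨m, c, hmc, hcp⟩ := geometric_hahn_banach_closed_point (convex_convexHull ℝ _)
    hcpt.isClosed hp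
  obtain ⟨u0, hu0, hmax⟩ := hcpt.exists_isMaxOn hne m.continuous.continuousOn
  have main : ∀ n : ℕ, ∀ m : E →L[ℝ] ℝ, (∀ x ∈ convexHull ℝ (V : Set E), m x ≤ m u0) →
      m u0 < m p → Module.finrank ℝ E ≤ n + Module.finrank ℝ (vectorSpan ℝ {x | x ∈ convexHull ℝ (V : Set E) ∧ m x = m u0}) →
      ∃ (m : E →L[ℝ] ℝ),
      (∀ x ∈ convexHull ℝ (V : Set E), m x ≤ m u0) ∧ m u0 < m p ∧
      Module.finrank ℝ (vectorSpan ℝ {x | x ∈ convexHull ℝ (V : Set E) ∧ m x = m u0}) + 1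
        = Module.finrank ℝ E := by
    intro n
    induction n with
    | zero =>
      intro m h1 h2 h3
      exfalso
      have h4 := Submodule.finrank_le (vectorSpan ℝ {x | x ∈ convexHull ℝ (V : Set E) ∧ m x = m u0})
      have := ds_eq_zero_of_const (by omega) m.toLinearMap (m u0) (fun x (hx : x ∈ {x | x ∈ convexHull ℝ (V : Set E) ∧ m x = m u0}) => hx.2)
      have e : ∀ x, m x = 0 := fun x => LinearMap.congr_fun this x
      rw [e, e] at h2
      exact lt_irrefl _ h2
    | succ n ih =>
      intro m h1 h2 h3
      rcases lt_trichotomy (Module.finrank ℝ (vectorSpan ℝ {x | x ∈ convexHull ℝ (V : Set E) ∧ m x = m u0}) + 1) (Module.finrank ℝ E) with h | h | h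
      · obtain ⟨m', a, b, c⟩ := ds_rotate V hdim p m u0 hu0 h1 h2 h
        exact ih m' a b (by omega)
      · exact ⟨m, h1, h2, h⟩
      · exact ih m h1 h2 (by omega)
  obtain ⟨m', a, b, c⟩ := main (Module.finrank ℝ E) m (fun x hx => hmax hx)
    ((hmc u0 hu0).trans hcp) (by omega)
  exact ⟨m', u0, hu0, a, b, c⟩

theorem ds_facet_unique [FiniteDimensional ℝ E] {P : Set E}
    (hdim : Module.finrank ℝ (vectorSpan ℝ P) = Module.finrank ℝ E)
    (m m' : E →L[ℝ] ℝ) (u0 : E)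
    (hm : ∀ x ∈ P, m x ≤ m u0) (hm' : ∀ x ∈ P, m' x ≤ m' u0)
    (heq : {x | x ∈ P ∧ m x = m u0} = {x | x ∈ P ∧ m' x = m' u0})
    (hr : Module.finrank ℝ (vectorSpan ℝ {x | x ∈ P ∧ m x = m u0}) + 1 = Module.finrank ℝ E)
    (p : E) (hp : m' u0 < m' p) : m u0 < m p := by
  have hex : ∃ u ∈ P, m u ≠ m u0 := by
    by_contra! hcon
    have : {x | x ∈ P ∧ m x = m u0} = P := by
      ext x; exact ⟨fun h => h.1, fun h => ⟨h, hcon x h⟩⟩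
    rw [this] at hr
    omega
  obtain ⟨u, hu, hne⟩ := hex
  have h1 : m u < m u0 := lt_of_le_of_ne (hm u hu) hne
  have h2 : m' u < m' u0 := by
    refine lt_of_le_of_ne (hm' u hu) (fun h => hne ?_)
    have : u ∈ {x | x ∈ P ∧ m' x = m' u0} := ⟨hu, h⟩
    rw [← heq] at this
    exact this.2
  let k : E →ₗ[ℝ] ℝ := (m' u0 - m' u) • m.toLinearMap - (m u0 - m u) • m'.toLinearMap
  have hk : ∀ x, k x = (m' u0 - m' u) * m x - (m u0 - m u) * m' x := fun x => rfl
  have hW : vectorSpan ℝ {x | x ∈ P ∧ m x = m u0} ≤ LinearMap.ker k := by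
    refine ds_const_on_span k (k u0) ?_
    intro x hx
    have hx' := hx
    rw [heq] at hx'
    rw [hk, hk, hx.2, hx'.2]
  have hku : u - u0 ∈ LinearMap.ker k := by
    rw [LinearMap.mem_ker, map_sub, hk, hk]; ring
  have hlt : vectorSpan ℝ {x | x ∈ P ∧ m x = m u0} < LinearMap.ker k := by
    refine lt_of_le_of_ne hW (fun h => ?_)
    rw [← h] at hku
    have := ds_const_on_span m.toLinearMap (m u0) (fun x (hx : x ∈ {x | x ∈ P ∧ m x = m u0}) => hx.2) hku
    simp only [LinearMap.mem_ker, map_sub, ContinuousLinearMap.coe_coe] at this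
    linarith
  have h3 := Submodule.finrank_lt_finrank_of_lt hlt
  have h4 := Submodule.finrank_le (LinearMap.ker k)
  have h5 := Submodule.eq_top_of_finrank_eq (show Module.finrank ℝ (LinearMap.ker k) = Module.finrank ℝ E by omega)
  have h6 : p - u0 ∈ LinearMap.ker k := h5 ▸ Submodule.mem_top
  rw [LinearMap.mem_ker, map_sub, hk, hk] at h6
  have h7 : (m' u0 - m' u) * (m p - m u0) = (m u0 - m u) * (m' p - m' u0) := by linarith
  have h8 : 0 < (m' u0 - m' u) * (m p - m u0) := by
    rw [h7]; exact mul_pos (by linarith) (by linarith)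
  have := (mul_pos_iff_of_pos_left (by linarith : 0 < m' u0 - m' u)).1 h8
  linarith

/-- Local structure at a simple vertex: in suitable coordinates, `P` lies in the orthant at `v`
and contains the unit vectors. -/
theorem ds_local_basis [FiniteDimensional ℝ E] (d : ℕ) (hd : 0 < d) (hE : Module.finrank ℝ E = d)
    (V : Finset E)
    (hdim : Module.finrank ℝ (vectorSpan ℝ (convexHull ℝ (V : Set E))) = d)
    (v : E) (hv : IsExposed ℝ (convexHull ℝ (V : Set E)) {v})
    (hs : Nat.card {G : Set E // IsExposed ℝ (convexHull ℝ (V : Set E)) G ∧ G.Nonempty ∧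
      Module.finrank ℝ (vectorSpan ℝ G) = d - 1 ∧ {v} ⊆ G} = d) :
    ∃ b : Module.Basis (Fin d) ℝ E, (∀ x ∈ convexHull ℝ (V : Set E), ∀ j, 0 ≤ b.repr (x - v) j) ∧
      ∀ j, v + b j ∈ convexHull ℝ (V : Set E) := by
  classical
  set P := convexHull ℝ (V : Set E) with hP
  obtain ⟨mv, hvP, hmv, hmveq⟩ := ds_exposed_data hv (Set.mem_singleton v)
  let T := {G : Set E // IsExposed ℝ P G ∧ G.Nonempty ∧
      Module.finrank ℝ (vectorSpan ℝ G) = d - 1 ∧ {v} ⊆ G}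
  have : Finite T := Nat.finite_of_card_ne_zero (by rw [hs]; omega)
  let e : T ≃ Fin d := Finite.equivFinOfCardEq hs
  have hdat : ∀ j : Fin d, ∃ m : E →L[ℝ] ℝ, (∀ x ∈ P, m x ≤ m v) ∧
      (e.symm j).1 = {x | x ∈ P ∧ m x = m v} := by
    intro j
    obtain ⟨m, -, h⟩ := ds_exposed_data (e.symm j).2.1 ((e.symm j).2.2.2.2 (Set.mem_singleton v))
    exact ⟨m, h⟩
  choose m hm hmG using hdat
  -- local description
  have hloc : ∀ z : E, (∀ j, m j z ≤ 0) →
      ∀ᶠ ε in nhdsWithin (0:ℝ) (Set.Ioi 0), v + ε • z ∈ P := by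
    intro z hz
    let A : Set (Set E) := {G | IsExposed ℝ P G ∧ G.Nonempty ∧
      Module.finrank ℝ (vectorSpan ℝ G) = d - 1 ∧ v ∉ G}
    have hAfin : A.Finite := (ds_faces_finite V).subset (fun G hG => hG.1)
    have hA : ∀ G ∈ A, ∀ᶠ ε in nhdsWithin (0:ℝ) (Set.Ioi 0),
        ∀ (m' : E →L[ℝ] ℝ) (u0 : E), u0 ∈ P → (∀ x ∈ P, m' x ≤ m' u0) →
          G = {x | x ∈ P ∧ m' x = m' u0} → ¬ (m' u0 < m' (v + ε • z)) := by
      rintro G ⟨hG1, ⟨g, hg⟩, hG3, hG4⟩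
      obtain ⟨n, hgP, hn, hGn⟩ := ds_exposed_data hG1 hg
      have hvn : n v < n g := by
        refine lt_of_le_of_ne (hn v hvP) (fun h => hG4 ?_)
        rw [hGn]; exact ⟨hvP, h⟩
      filter_upwards [ds_eventually_small (a := n z) (sub_pos.2 hvn)] with ε hε m' u0 hu0 hm' hG' hlt
      have hu0G : u0 ∈ G := by rw [hG']; exact ⟨hu0, rfl⟩
      have hnu : n u0 = n g := by rw [hGn] at hu0G; exact hu0G.2
      have := ds_facet_unique (by rw [hdim, hE]) n m' u0 (by rw [hnu]; exact hn) hm'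
        (by rw [hnu, ← hGn, hG']) (by rw [hnu, ← hGn, hG3, hE]; omega) _ hlt
      rw [map_add, map_smul, smul_eq_mul] at this
      linarith
    have hA' := (Filter.eventually_all_finite hAfin).2 hA
    filter_upwards [hA', ds_eventually_pos] with ε hε hε0
    by_contra hcon
    obtain ⟨m', u0, hu0, h1, h2, h3⟩ := ds_facet_sep V (by rw [hdim, hE]) ⟨v, hvP⟩ _ hcon
    have hGexp := ds_exposed_mk m' hu0 h1
    by_cases hvG : v ∈ {x | x ∈ P ∧ m' x = m' u0}
    · let G : T := ⟨{x | x ∈ P ∧ m' x = m' u0}, hGexp, ⟨v, hvG⟩, Nat.eq_sub_of_add_eq (h3.trans hE), by simpa using hvG⟩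
      have hG := hmG (e G)
      rw [Equiv.symm_apply_apply] at hG
      have hG' : {x | x ∈ P ∧ m' x = m' u0} = {x | x ∈ P ∧ m (e G) x = m (e G) v} := hG
      have h4 := ds_facet_unique (by rw [hdim, hE]) (m (e G)) m' v (hm _) (by rw [hvG.2]; exact h1)
        (by rw [hvG.2, hG']) (by rw [← hG']; exact h3) (v + ε • z) (by rw [hvG.2]; exact h2)
      rw [map_add, map_smul, smul_eq_mul] at h4
      nlinarith [hz (e G)]
    · exact hε _ ⟨hGexp, ⟨u0, hu0, rfl⟩, Nat.eq_sub_of_add_eq (h3.trans hE), hvG⟩ m' u0 hu0 h1 rfl h2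
  let L : E →ₗ[ℝ] (Fin d → ℝ) := LinearMap.pi (fun j => (m j).toLinearMap)
  have hL : ∀ x j, L x j = m j x := fun x j => rfl
  have hinj : Function.Injective L := by
    rw [← LinearMap.ker_eq_bot, LinearMap.ker_eq_bot']
    intro z hz
    have hz' : ∀ j, m j z = 0 := fun j => by rw [← hL, hz]; rfl
    obtain ⟨ε, ⟨h1, h2⟩, h3⟩ := (((hloc z (fun j => (hz' j).le)).and
      (hloc (-z) (fun j => by simp [hz' j]))).and ds_eventually_pos).exists
    have a1 := hmv _ h1
    have a2 := hmv _ h2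
    simp only [map_add, map_smul, map_neg, smul_eq_mul] at a1 a2
    have : v + ε • z ∈ ({v} : Set E) := by
      rw [hmveq]
      refine ⟨h1, ?_⟩
      simp only [map_add, map_smul, smul_eq_mul]
      linarith
    simpa [h3.ne'] using this
  let Le : E ≃ₗ[ℝ] (Fin d → ℝ) := LinearMap.linearEquivOfInjective L hinj (by simp [hE])
  have hLe : ∀ x j, Le x j = m j x := fun x j => rfl
  have hz : ∀ j : Fin d, ∀ᶠ ε in nhdsWithin (0:ℝ) (Set.Ioi 0),
      v + ε • Le.symm (-Pi.single j 1) ∈ P := by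
    intro j
    apply hloc
    intro i
    rw [← hLe, LinearEquiv.apply_symm_apply]
    by_cases h : i = j
    · subst h; simp
    · simp [h]
  obtain ⟨ε, hε, hε0⟩ := ((Filter.eventually_all.2 hz).and ds_eventually_pos).exists
  let c : Units ℝ := Units.mk0 (-ε⁻¹) (by simp [hε0.ne'])
  let b := Module.Basis.ofEquivFun (Le.trans (LinearEquiv.smulOfUnit (M := Fin d → ℝ) c))
  have hbr : ∀ x j, b.repr x j = -ε⁻¹ * m j x := fun x j => rfl
  refine ⟨b, ?_, ?_⟩
  · intro x hx j
    rw [hbr, map_sub]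
    have := hm j x hx
    have h2 : 0 < ε⁻¹ := inv_pos.2 hε0
    nlinarith
  · intro j
    have : b j = ε • Le.symm (-Pi.single j 1) := by
      apply b.repr.injective
      ext i
      rw [Module.Basis.repr_self, hbr, ContinuousLinearMap.map_smul, ← hLe,
        LinearEquiv.apply_symm_apply]
      by_cases h : i = j
      · subst h; simp [hε0.ne']
      · simp [h]
    rw [this]
    exact hε j

/-- the face at `v` spanned by the coordinate directions in `S` -/
def dsFace {d : ℕ} (P : Set E) (v : E) (b : Module.Basis (Fin d) ℝ E) (S : Finset (Fin d)) : Set E :=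
  {x | x ∈ P ∧ ∀ j ∉ S, b.repr (x - v) j = 0}

section Local

variable {d : ℕ} {P : Set E} {v : E} {b : Module.Basis (Fin d) ℝ E}

theorem dsFace_v (hv : v ∈ P) (S : Finset (Fin d)) : v ∈ dsFace P v b S := ⟨hv, by simp⟩

theorem dsFace_b (h2 : ∀ j, v + b j ∈ P) (S : Finset (Fin d)) (j : Fin d) :
    v + b j ∈ dsFace P v b S ↔ j ∈ S := by
  constructor
  · intro h
    by_contra hj
    have := h.2 j hj
    simp at this
  · intro hj
    refine ⟨h2 j, fun i hi => ?_⟩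
    have : j ≠ i := fun h => hi (h ▸ hj)
    simp [this]

theorem ds_apply_expand (m : E →ₗ[ℝ] ℝ) (x : E) :
    m x = m v + ∑ j, b.repr (x - v) j * m (b j) := by
  have h := b.sum_repr (x - v)
  have h2 : m (x - v) = ∑ j, b.repr (x - v) j * m (b j) := by
    conv_lhs => rw [← h]
    simp
  rw [map_sub] at h2
  linarith

theorem dsFace_exposed [FiniteDimensional ℝ E] (hv : v ∈ P)
    (h1 : ∀ x ∈ P, ∀ j, 0 ≤ b.repr (x - v) j)
    (S : Finset (Fin d)) : IsExposed ℝ P (dsFace P v b S) := by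
  classical
  let m0 : E →ₗ[ℝ] ℝ := -∑ j ∈ Sᶜ, b.coord j
  let m : E →L[ℝ] ℝ := LinearMap.toContinuousLinearMap m0
  have hm : ∀ x, m x = m v - ∑ j ∈ Sᶜ, b.repr (x - v) j := by
    intro x
    have : m0 x = m0 v - ∑ j ∈ Sᶜ, b.repr (x - v) j := by
      simp [m0]
      ring
    exact this
  have hE := ds_exposed_mk m hv (fun x hx => by
    rw [hm x]
    have := Finset.sum_nonneg (s := Sᶜ) (fun j _ => h1 x hx j)
    linarith)
  convert hE using 1
  ext x
  constructor
  · rintro ⟨hx, hx2⟩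
    refine ⟨hx, ?_⟩
    rw [hm x, Finset.sum_eq_zero (fun j hj => hx2 j (Finset.mem_compl.1 hj)), sub_zero]
  · rintro ⟨hx, hx2⟩
    refine ⟨hx, fun j hj => ?_⟩
    rw [hm x] at hx2
    exact (Finset.sum_eq_zero_iff_of_nonneg (fun j _ => h1 x hx j)).1 (by linarith) j
      (Finset.mem_compl.2 hj)

theorem dsFace_finrank (hv : v ∈ P) (h2 : ∀ j, v + b j ∈ P) (S : Finset (Fin d)) :
    Module.finrank ℝ (vectorSpan ℝ (dsFace P v b S)) = S.card := by
  have hspan : vectorSpan ℝ (dsFace P v b S) =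
      Submodule.span ℝ (Set.range (fun j : S => b j)) := by
    apply le_antisymm
    · rw [vectorSpan_eq_span_vsub_set_right ℝ (dsFace_v (b := b) hv S), Submodule.span_le]
      rintro _ ⟨x, hx, rfl⟩
      change x - v ∈ _
      rw [← b.sum_repr (x - v)]
      refine Submodule.sum_mem _ (fun j _ => ?_)
      by_cases hj : j ∈ S
      · exact Submodule.smul_mem _ _ (Submodule.subset_span ⟨⟨j, hj⟩, rfl⟩)
      · rw [hx.2 j hj, zero_smul]; exact Submodule.zero_mem _
    · rw [Submodule.span_le]
      rintro _ ⟨⟨j, hj⟩, rfl⟩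
      have := vsub_mem_vectorSpan ℝ ((dsFace_b h2 S j).2 hj) (dsFace_v (b := b) hv S)
      simpa using this
  have hli : LinearIndependent ℝ (fun j : S => b j) :=
    b.linearIndependent.comp _ Subtype.val_injective
  rw [hspan, finrank_span_eq_card hli]
  simp

theorem ds_exposed_eq_dsFace (h1 : ∀ x ∈ P, ∀ j, 0 ≤ b.repr (x - v) j)
    (h2 : ∀ j, v + b j ∈ P) {F : Set E} (hF : IsExposed ℝ P F) (hvF : v ∈ F) :
    ∃ S : Finset (Fin d), F = dsFace P v b S := by
  classical
  obtain ⟨m, hv, hm, hFm⟩ := ds_exposed_data hF hvF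
  have hneg : ∀ j, m (b j) ≤ 0 := by
    intro j
    have := hm _ (h2 j)
    rw [map_add] at this
    linarith
  refine ⟨Finset.univ.filter (fun j => m (b j) = 0), ?_⟩
  rw [hFm]
  ext x
  have hx := ds_apply_expand (v := v) (b := b) m.toLinearMap x
  simp only [ContinuousLinearMap.coe_coe] at hx
  constructor
  · rintro ⟨hxP, hxm⟩
    refine ⟨hxP, fun j hj => ?_⟩
    have h0 : ∑ j, b.repr (x - v) j * m (b j) = 0 := by linarith
    have h3 := (Finset.sum_eq_zero_iff_of_nonpos
      (fun j _ => mul_nonpos_of_nonneg_of_nonpos (h1 x hxP j) (hneg j))).1 h0 j (Finset.mem_univ j)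
    rcases mul_eq_zero.1 h3 with h | h
    · exact h
    · exact absurd (Finset.mem_filter.2 ⟨Finset.mem_univ j, h⟩) hj
  · rintro ⟨hxP, hxS⟩
    refine ⟨hxP, ?_⟩
    rw [hx, Finset.sum_eq_zero, add_zero]
    intro j _
    by_cases hj : m (b j) = 0
    · rw [hj, mul_zero]
    · rw [hxS j (by simp [hj]), zero_mul]

theorem ds_count [FiniteDimensional ℝ E] (hv : v ∈ P)
    (h1 : ∀ x ∈ P, ∀ j, 0 ≤ b.repr (x - v) j)
    (h2 : ∀ j, v + b j ∈ P) (φ : E →L[ℝ] ℝ) (hφ : ∀ j, φ (b j) ≠ 0) (k : ℕ) :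
    {F : Set E | (IsExposed ℝ P F ∧ F.Nonempty ∧ Module.finrank ℝ (vectorSpan ℝ F) = k) ∧
      v ∈ F ∧ ∀ x ∈ F, φ x ≤ φ v}.ncard =
    (Finset.univ.filter (fun j => φ (b j) < 0)).card.choose k := by
  classical
  have himg : {F : Set E | (IsExposed ℝ P F ∧ F.Nonempty ∧ Module.finrank ℝ (vectorSpan ℝ F) = k) ∧
      v ∈ F ∧ ∀ x ∈ F, φ x ≤ φ v} = dsFace P v b ''
      ((Finset.univ.filter (fun j => φ (b j) < 0)).powersetCard k : Finset (Finset (Fin d))) := by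
    ext F
    simp only [Set.mem_image, Finset.mem_coe, Finset.mem_powersetCard]
    constructor
    · rintro ⟨⟨hF, -, hk⟩, hvF, hmax⟩
      obtain ⟨S, rfl⟩ := ds_exposed_eq_dsFace h1 h2 hF hvF
      rw [dsFace_finrank hv h2] at hk
      refine ⟨S, ⟨fun j hj => ?_, hk⟩, rfl⟩
      have := hmax _ ((dsFace_b h2 S j).2 hj)
      rw [map_add] at this
      exact Finset.mem_filter.2 ⟨Finset.mem_univ _, lt_of_le_of_ne (by linarith) (hφ j)⟩
    · rintro ⟨S, ⟨hS, hk⟩, rfl⟩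
      refine ⟨⟨dsFace_exposed hv h1 S, ⟨v, dsFace_v hv S⟩, ?_⟩, dsFace_v hv S, ?_⟩
      · rw [dsFace_finrank hv h2, hk]
      · intro x hx
        have hx' := ds_apply_expand (v := v) (b := b) φ.toLinearMap x
        simp only [ContinuousLinearMap.coe_coe] at hx'
        have : ∑ j, b.repr (x - v) j * φ (b j) ≤ 0 := by
          refine Finset.sum_nonpos (fun j _ => ?_)
          by_cases hj : j ∈ S
          · exact mul_nonpos_of_nonneg_of_nonpos (h1 x hx.1 j) (Finset.mem_filter.1 (hS hj)).2.le
          · rw [hx.2 j hj, zero_mul]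
        linarith
  rw [himg, Set.ncard_image_of_injective, Set.ncard_coe_finset, Finset.card_powersetCard]
  intro S S' h
  ext j
  rw [← dsFace_b h2 S j, ← dsFace_b h2 S' j, h]

end Local

theorem ds_ne_zero [FiniteDimensional ℝ E] {d : ℕ} (V : Finset E) {v : E}
    {b : Module.Basis (Fin d) ℝ E} (hv : v ∈ convexHull ℝ (V : Set E))
    (h1 : ∀ x ∈ convexHull ℝ (V : Set E), ∀ j, 0 ≤ b.repr (x - v) j)
    (h2 : ∀ j, v + b j ∈ convexHull ℝ (V : Set E)) (φ : E →L[ℝ] ℝ)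
    (hφ : ∀ u ∈ V, ∀ v ∈ V, φ u = φ v → u = v) (j : Fin d) : φ (b j) ≠ 0 := by
  intro h0
  obtain ⟨w, -, hwF, -, hw⟩ := ds_top_vertex V φ hφ (dsFace_exposed hv h1 {j})
    ⟨v, dsFace_v hv _⟩
  have hc : ∀ x ∈ dsFace (convexHull ℝ (V : Set E)) v b {j}, φ x = φ v := by
    intro x hx
    have hx' := ds_apply_expand (v := v) (b := b) φ.toLinearMap x
    simp only [ContinuousLinearMap.coe_coe] at hx'
    rw [hx', Finset.sum_eq_zero, add_zero]
    intro i _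
    by_cases hi : i = j
    · rw [hi, h0, mul_zero]
    · rw [hx.2 i (by simpa using hi), zero_mul]
  have a1 := dsFace_v (b := b) hv {j}
  have a2 := (dsFace_b h2 {j} j).2 (by simp)
  have e1 := (hw _ a1).2 (hc w hwF).symm
  have e2 := (hw _ a2).2 ((hc _ a2).trans (hc w hwF).symm)
  have : b j = 0 := by simpa using e2.trans e1.symm
  exact b.ne_zero j this

open Classical in
theorem ds_sum (V : Finset E) (φ : E →L[ℝ] ℝ)
    (hφ : ∀ u ∈ V, ∀ v ∈ V, φ u = φ v → u = v) (k : ℕ) :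
    Nat.card {F : Set E // IsExposed ℝ (convexHull ℝ (V : Set E)) F ∧ F.Nonempty ∧
      Module.finrank ℝ (vectorSpan ℝ F) = k} =
    ∑ v ∈ V.filter (fun v => IsExposed ℝ (convexHull ℝ (V : Set E)) {v}),
      {F : Set E | (IsExposed ℝ (convexHull ℝ (V : Set E)) F ∧ F.Nonempty ∧
        Module.finrank ℝ (vectorSpan ℝ F) = k) ∧ v ∈ F ∧ ∀ x ∈ F, φ x ≤ φ v}.ncard := by
  set P := convexHull ℝ (V : Set E) with hP
  have hfin : {F : Set E | IsExposed ℝ P F ∧ F.Nonempty ∧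
      Module.finrank ℝ (vectorSpan ℝ F) = k}.Finite := (ds_faces_finite V).subset (fun F h => h.1)
  have hex : ∀ F : Set E, ∃ w, (IsExposed ℝ P F ∧ F.Nonempty) → (w ∈ V ∧ w ∈ F ∧ IsExposed ℝ P {w} ∧
      ∀ x ∈ F, φ x ≤ φ w ∧ (φ x = φ w → x = w)) := by
    intro F
    by_cases h : IsExposed ℝ P F ∧ F.Nonempty
    · obtain ⟨w, hw⟩ := ds_top_vertex V φ hφ h.1 h.2
      exact ⟨w, fun _ => hw⟩
    · exact ⟨0, fun h' => absurd h' h⟩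
  choose top htop using hex
  have hcard : Nat.card {F : Set E // IsExposed ℝ P F ∧ F.Nonempty ∧
      Module.finrank ℝ (vectorSpan ℝ F) = k} = hfin.toFinset.card := by
    rw [← Set.ncard_eq_toFinset_card _ hfin]
    rfl
  rw [hcard, Finset.card_eq_sum_card_fiberwise (f := top)
    (t := V.filter (fun v => IsExposed ℝ P {v}))]
  · refine Finset.sum_congr rfl (fun v hv => ?_)
    rw [← Set.ncard_coe_finset]
    congr 1
    ext F
    simp only [Finset.coe_filter, Set.Finite.mem_toFinset, Set.mem_ofPred_eq]
    constructor
    · rintro ⟨h, rfl⟩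
      obtain ⟨a1, a2, a3, a4⟩ := htop F ⟨h.1, h.2.1⟩
      exact ⟨h, a2, fun x hx => (a4 x hx).1⟩
    · rintro ⟨h, h2, h3⟩
      obtain ⟨a1, a2, a3, a4⟩ := htop F ⟨h.1, h.2.1⟩
      exact ⟨h, ((a4 v h2).2 (le_antisymm (a4 v h2).1 (h3 _ a2))).symm⟩
  · intro F hF
    have hF' := hfin.mem_toFinset.1 hF
    obtain ⟨a1, a2, a3, a4⟩ := htop F ⟨hF'.1, hF'.2.1⟩
    exact Finset.mem_coe.2 (Finset.mem_filter.2 ⟨a1, a3⟩)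

end Geometry

theorem ds_binom (n : ℕ) : ∀ d l : ℕ, n ≤ d → l ≤ d →
    ∑ i ∈ Finset.range (l + 1), (-1 : ℝ) ^ i * ((d - i).choose (d - l) : ℝ) * (n.choose i : ℝ) =
      ((d - n).choose l : ℝ) := by
  induction n with
  | zero =>
    intro d l _ hl
    rw [Finset.sum_eq_single 0]
    · simp [Nat.choose_symm hl]
    · intro i _ hi
      simp [Nat.choose_eq_zero_of_lt (Nat.pos_of_ne_zero hi)]
    · simp
  | succ n ih =>
    intro d l hn hl
    obtain ⟨d, rfl⟩ : ∃ d', d = d' + 1 := ⟨d - 1, by omega⟩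
    have e0 := ih (d + 1) l (by omega) hl
    rcases l with _ | l
    · simp
    have e1 := ih d l (by omega) (by omega)
    have hsplit : ∑ i ∈ Finset.range (l + 1 + 1), (-1 : ℝ) ^ i * ((d + 1 - i).choose (d + 1 - (l + 1)) : ℝ) * ((n + 1).choose i : ℝ)
        = ∑ i ∈ Finset.range (l + 1 + 1), (-1 : ℝ) ^ i * ((d + 1 - i).choose (d + 1 - (l + 1)) : ℝ) * (n.choose i : ℝ)
        - ∑ i ∈ Finset.range (l + 1), (-1 : ℝ) ^ i * ((d - i).choose (d - l) : ℝ) * (n.choose i : ℝ) := by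
      rw [Finset.sum_range_succ' _ (l + 1), Finset.sum_range_succ' _ (l + 1), add_sub_right_comm,
        ← Finset.sum_sub_distrib]
      congr 1
      · refine Finset.sum_congr rfl (fun i _ => ?_)
        rw [Nat.choose_succ_succ, Nat.add_sub_add_right, Nat.add_sub_add_right]
        push_cast
        ring
      · simp
    rw [hsplit, e0, e1, Nat.add_sub_add_right, show d + 1 - n = (d - n) + 1 by omega,
      Nat.choose_succ_succ]
    push_cast
    ring

theorem dehn_sommerville (d : ℕ) (V : Finset (EuclideanSpace ℝ (Fin d)))
    (P : Set (EuclideanSpace ℝ (Fin d)))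
    (hP : P = convexHull ℝ (V : Set (EuclideanSpace ℝ (Fin d))))
    (hdim : Module.finrank ℝ (vectorSpan ℝ P) = d)
    (hsimple : IsSimplePolytope d P) :
    ∀ l ≤ d, (faceCount d P l : ℝ) =
      ∑ i ∈ Finset.range (l + 1),
        (-1 : ℝ) ^ i * ((d - i).choose (d - l) : ℝ) * (faceCount d P i : ℝ) := by
  classical
  intro l hl
  subst hP
  rcases Nat.eq_zero_or_pos d with hd | hd
  · subst hd
    obtain rfl : l = 0 := by omega
    simp
  have hE : Module.finrank ℝ (EuclideanSpace ℝ (Fin d)) = d := by simp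
  -- a functional that is injective on the generators
  obtain ⟨φ, hφ⟩ : ∃ φ : EuclideanSpace ℝ (Fin d) →L[ℝ] ℝ,
      ∀ u ∈ V, ∀ v ∈ V, φ u = φ v → u = v := by
    obtain ⟨f, hf⟩ := Module.exists_dual_forall_apply_ne_zero (K := ℝ)
      (fun p : {p : V × V // p.1 ≠ p.2} => (p.1.1 : EuclideanSpace ℝ (Fin d)) - p.1.2)
      (fun p => sub_ne_zero.2 (fun h => p.2 (Subtype.ext h)))
    refine ⟨LinearMap.toContinuousLinearMap f, fun u hu v hv h => ?_⟩
    by_contra hne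
    refine hf ⟨(⟨u, hu⟩, ⟨v, hv⟩), fun h => hne (congrArg Subtype.val h)⟩ ?_
    rw [map_sub]
    exact sub_eq_zero.2 h
  have hφ' : ∀ u ∈ V, ∀ v ∈ V, (-φ) u = (-φ) v → u = v := by
    intro u hu v hv h
    exact hφ u hu v hv (by simpa using h)
  have hb : ∀ v ∈ V.filter (fun v => IsExposed ℝ (convexHull ℝ (V : Set (EuclideanSpace ℝ (Fin d)))) {v}),
      ∃ n : ℕ, n ≤ d ∧ ∀ k,
        {F : Set (EuclideanSpace ℝ (Fin d)) | (IsExposed ℝ (convexHull ℝ (V : Set (EuclideanSpace ℝ (Fin d)))) F ∧ F.Nonempty ∧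
          Module.finrank ℝ (vectorSpan ℝ F) = k) ∧ v ∈ F ∧ ∀ x ∈ F, φ x ≤ φ v}.ncard = n.choose k ∧
        {F : Set (EuclideanSpace ℝ (Fin d)) | (IsExposed ℝ (convexHull ℝ (V : Set (EuclideanSpace ℝ (Fin d)))) F ∧ F.Nonempty ∧
          Module.finrank ℝ (vectorSpan ℝ F) = k) ∧ v ∈ F ∧ ∀ x ∈ F, (-φ) x ≤ (-φ) v}.ncard =
            (d - n).choose k := by
    intro v hv
    obtain ⟨hvV, hvE⟩ := Finset.mem_filter.1 hv
    have hvP : v ∈ convexHull ℝ (V : Set (EuclideanSpace ℝ (Fin d))) := subset_convexHull ℝ _ hvV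
    obtain ⟨b, h1, h2⟩ := ds_local_basis d hd hE V hdim v hvE
      (hsimple {v} hvE (Set.singleton_nonempty v) (by simp))
    have hne := ds_ne_zero V hvP h1 h2 φ hφ
    refine ⟨(Finset.univ.filter (fun j => φ (b j) < 0)).card, ?_, fun k => ⟨?_, ?_⟩⟩
    · simpa using Finset.card_le_univ (Finset.univ.filter (fun j => φ (b j) < 0))
    · exact ds_count hvP h1 h2 φ hne k
    · rw [ds_count hvP h1 h2 (-φ) (fun j => by simpa using hne j) k]
      congr 1
      have hs := Finset.card_filter_add_card_filter_not (s := (Finset.univ : Finset (Fin d)))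
        (fun j => φ (b j) < 0)
      have hs2 : Finset.univ.filter (fun j => (-φ) (b j) < 0) =
          Finset.univ.filter (fun j => ¬ φ (b j) < 0) := by
        ext j
        have := hne j
        simp only [Finset.mem_filter, Finset.mem_univ, true_and, neg_apply]
        constructor
        · intro h; linarith
        · intro h
          have := lt_of_le_of_ne (not_lt.1 h) (hne j).symm
          linarith
      rw [hs2]
      simp only [Finset.card_univ, Fintype.card_fin] at hs
      omega
  choose! n hn hcount using hb
  have hf1 : ∀ k, faceCount d (convexHull ℝ (V : Set (EuclideanSpace ℝ (Fin d)))) k =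
      ∑ v ∈ V.filter (fun v => IsExposed ℝ (convexHull ℝ (V : Set (EuclideanSpace ℝ (Fin d)))) {v}),
        (n v).choose k := by
    intro k
    unfold faceCount
    rw [ds_sum V φ hφ k]
    exact Finset.sum_congr rfl (fun v hv => (hcount v hv k).1)
  have hf2 : ∀ k, faceCount d (convexHull ℝ (V : Set (EuclideanSpace ℝ (Fin d)))) k =
      ∑ v ∈ V.filter (fun v => IsExposed ℝ (convexHull ℝ (V : Set (EuclideanSpace ℝ (Fin d)))) {v}),
        (d - n v).choose k := by
    intro k
    unfold faceCount
    rw [ds_sum V (-φ) hφ' k]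
    exact Finset.sum_congr rfl (fun v hv => (hcount v hv k).2)
  rw [hf2 l]
  simp only [hf1]
  push_cast
  simp only [Finset.mul_sum]
  rw [Finset.sum_comm]
  exact Finset.sum_congr rfl (fun v hv => (ds_binom (n v) d l (hn v hv) hl).symm)
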